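/- arXiv:1803.06931 — 4 statements merged into one kernel-verified Lean document; each statement's English description precedes it below -/
import Mathlib

section
/- The exponential E₁ is left and right monogenic: for every ζ ∈ ℂ², the function x ↦ E₁(x,ζ) is differentiable on ℝ³ and satisfies D⁽ˡ⁾E₁(·,ζ) = 0 and D⁽ʳ⁾E₁(·,ζ) = 0 on all of ℝ³. -/
open scoped Quaternion

noncomputable section

/-- The basis element `e₁` of the complex Clifford algebra `ℂ₍₂₎ = ℍ[ℂ]`. -/
def e1 : ℍ[ℂ] := ⟨0, 1, 0, 0⟩

/-- The basis element `e₂` of the complex Clifford algebra `ℂ₍₂₎ = ℍ[ℂ]`. -/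
def e2 : ℍ[ℂ] := ⟨0, 0, 1, 0⟩

/-- `ζ_vec = ζ₁ e₁ + ζ₂ e₂`. -/
def zvec (ζ : ℂ × ℂ) : ℍ[ℂ] := ⟨0, ζ.1, ζ.2, 0⟩

/-- The exponential power series `Σ_{k≥0} (1/k!) Aᵏ` in `ℂ₍₂₎`, computed componentwise. -/
def qexp (A : ℍ[ℂ]) : ℍ[ℂ] :=
  ⟨∑' k : ℕ, (k.factorial : ℂ)⁻¹ * (A ^ k).re,
   ∑' k : ℕ, (k.factorial : ℂ)⁻¹ * (A ^ k).imI,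
   ∑' k : ℕ, (k.factorial : ℂ)⁻¹ * (A ^ k).imJ,
   ∑' k : ℕ, (k.factorial : ℂ)⁻¹ * (A ^ k).imK⟩

/-- `E₁(x,ζ) = exp(i(x₁ζ₁ + x₂ζ₂)e₀ − i x₀ ζ_vec)`. -/
def E1 (x : Fin 3 → ℝ) (ζ : ℂ × ℂ) : ℍ[ℂ] :=
  qexp ((Complex.I * ((x 1 : ℂ) * ζ.1 + (x 2 : ℂ) * ζ.2)) • (1 : ℍ[ℂ])
    - (Complex.I * (x 0 : ℂ)) • zvec ζ)

/-- Componentwise partial derivative of a `ℂ₍₂₎`-valued function in the `j`-th direction. -/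
def pdQ (j : Fin 3) (f : (Fin 3 → ℝ) → ℍ[ℂ]) (x : Fin 3 → ℝ) : ℍ[ℂ] :=
  ⟨fderiv ℝ (fun y => (f y).re) x (Pi.single j 1),
   fderiv ℝ (fun y => (f y).imI) x (Pi.single j 1),
   fderiv ℝ (fun y => (f y).imJ) x (Pi.single j 1),
   fderiv ℝ (fun y => (f y).imK) x (Pi.single j 1)⟩

/-- Componentwise differentiability of a `ℂ₍₂₎`-valued function. -/
def QDiffAt (f : (Fin 3 → ℝ) → ℍ[ℂ]) (x : Fin 3 → ℝ) : Prop :=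
  DifferentiableAt ℝ (fun y => (f y).re) x ∧ DifferentiableAt ℝ (fun y => (f y).imI) x ∧
  DifferentiableAt ℝ (fun y => (f y).imJ) x ∧ DifferentiableAt ℝ (fun y => (f y).imK) x

/-- The left Cauchy–Riemann operator `D⁽ˡ⁾f = ∂₀f + e₁ ∂₁f + e₂ ∂₂f`. -/
def Dl (f : (Fin 3 → ℝ) → ℍ[ℂ]) (x : Fin 3 → ℝ) : ℍ[ℂ] :=
  pdQ 0 f x + e1 * pdQ 1 f x + e2 * pdQ 2 f x

/-- The right Cauchy–Riemann operator `D⁽ʳ⁾f = ∂₀f + (∂₁f) e₁ + (∂₂f) e₂`. -/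
def Dr (f : (Fin 3 → ℝ) → ℍ[ℂ]) (x : Fin 3 → ℝ) : ℍ[ℂ] :=
  pdQ 0 f x + pdQ 1 f x * e1 + pdQ 2 f x * e2

/-- The conjugate left Cauchy–Riemann operator `D̄⁽ˡ⁾f = ∂₀f − e₁ ∂₁f − e₂ ∂₂f`. -/
def Dbar (f : (Fin 3 → ℝ) → ℍ[ℂ]) (x : Fin 3 → ℝ) : ℍ[ℂ] :=
  pdQ 0 f x - e1 * pdQ 1 f x - e2 * pdQ 2 f x

/-- The element `a + b e₁ + c e₂ + d e₃` of `ℂ₍₂₎`. -/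
def cliffordMk (a b c d : ℂ) : ℍ[ℂ] := ⟨a, b, c, d⟩

section Components

variable (a b c d : ℂ) (ζ : ℂ × ℂ) (j : Fin 3) (f : (Fin 3 → ℝ) → ℍ[ℂ]) (x : Fin 3 → ℝ)

@[simp] theorem re_cliffordMk : (cliffordMk a b c d).re = a := rfl
@[simp] theorem imI_cliffordMk : (cliffordMk a b c d).imI = b := rfl
@[simp] theorem imJ_cliffordMk : (cliffordMk a b c d).imJ = c := rfl
@[simp] theorem imK_cliffordMk : (cliffordMk a b c d).imK = d := rfl

@[simp] theorem re_e1 : e1.re = 0 := rfl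
@[simp] theorem imI_e1 : e1.imI = 1 := rfl
@[simp] theorem imJ_e1 : e1.imJ = 0 := rfl
@[simp] theorem imK_e1 : e1.imK = 0 := rfl

@[simp] theorem re_e2 : e2.re = 0 := rfl
@[simp] theorem imI_e2 : e2.imI = 0 := rfl
@[simp] theorem imJ_e2 : e2.imJ = 1 := rfl
@[simp] theorem imK_e2 : e2.imK = 0 := rfl

@[simp] theorem re_zvec : (zvec ζ).re = 0 := rfl
@[simp] theorem imI_zvec : (zvec ζ).imI = ζ.1 := rfl
@[simp] theorem imJ_zvec : (zvec ζ).imJ = ζ.2 := rfl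
@[simp] theorem imK_zvec : (zvec ζ).imK = 0 := rfl

@[simp] theorem re_pdQ : (pdQ j f x).re = fderiv ℝ (fun y => (f y).re) x (Pi.single j 1) := rfl
@[simp] theorem imI_pdQ : (pdQ j f x).imI = fderiv ℝ (fun y => (f y).imI) x (Pi.single j 1) := rfl
@[simp] theorem imJ_pdQ : (pdQ j f x).imJ = fderiv ℝ (fun y => (f y).imJ) x (Pi.single j 1) := rfl
@[simp] theorem imK_pdQ : (pdQ j f x).imK = fderiv ℝ (fun y => (f y).imK) x (Pi.single j 1) := rfl

end Components

theorem cliffordMk_mul_smul_one_add_smul_zvec (ζ : ℂ × ℂ) (s t p q : ℂ) :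
    cliffordMk p (q * ζ.1) (q * ζ.2) 0 * (s • (1 : ℍ[ℂ]) + t • zvec ζ) =
      cliffordMk (s * p - t * (ζ.1 ^ 2 + ζ.2 ^ 2) * q)
        ((s * q + t * p) * ζ.1) ((s * q + t * p) * ζ.2) 0 := by
  apply Quaternion.ext <;> simp <;> ring

/-- Powers of `s + t ζ_vec`, in terms of any solution of the two-term recurrence they obey. -/
theorem smul_one_add_smul_zvec_pow (ζ : ℂ × ℂ) (s t : ℂ) (p q : ℕ → ℂ)
    (hp0 : p 0 = 1) (hq0 : q 0 = 0)
    (hp : ∀ k, p (k + 1) = s * p k - t * (ζ.1 ^ 2 + ζ.2 ^ 2) * q k)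
    (hq : ∀ k, q (k + 1) = s * q k + t * p k) (k : ℕ) :
    (s • (1 : ℍ[ℂ]) + t • zvec ζ) ^ k = cliffordMk (p k) (q k * ζ.1) (q k * ζ.2) 0 := by
  induction k with
  | zero => apply Quaternion.ext <;> simp [hp0, hq0]
  | succ k ih =>
    rw [pow_succ, ih, cliffordMk_mul_smul_one_add_smul_zvec, hp, hq]

/-- The exponential of `s + t ζ_vec`, once the scalar component series are summed. -/
theorem qexp_smul_one_add_smul_zvec (ζ : ℂ × ℂ) (s t : ℂ) (p q : ℕ → ℂ)
    (hp0 : p 0 = 1) (hq0 : q 0 = 0)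
    (hp : ∀ k, p (k + 1) = s * p k - t * (ζ.1 ^ 2 + ζ.2 ^ 2) * q k)
    (hq : ∀ k, q (k + 1) = s * q k + t * p k) {P Q : ℂ}
    (hP : HasSum (fun k : ℕ => (k.factorial : ℂ)⁻¹ * p k) P)
    (hQ : HasSum (fun k : ℕ => (k.factorial : ℂ)⁻¹ * q k) Q) :
    qexp (s • (1 : ℍ[ℂ]) + t • zvec ζ) =
      cliffordMk P (Q * ζ.1) (Q * ζ.2) 0 := by
  unfold qexp
  simp only [smul_one_add_smul_zvec_pow ζ s t p q hp0 hq0 hp hq, re_cliffordMk,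
    imI_cliffordMk, imJ_cliffordMk, imK_cliffordMk, ← mul_assoc, tsum_mul_right,
    hP.tsum_eq, hQ.tsum_eq, mul_zero, tsum_zero]
  rfl

theorem hasSum_inv_factorial_mul_pow (z : ℂ) :
    HasSum (fun k : ℕ => (k.factorial : ℂ)⁻¹ * z ^ k) (Complex.exp z) := by
  have h := NormedSpace.expSeries_div_hasSum_exp (𝔸 := ℂ) z
  rw [← Complex.exp_eq_exp_ℂ] at h
  simpa only [div_eq_inv_mul] using h

theorem hasSum_inv_factorial_mul_natCast_mul_pow_pred (z : ℂ) :
    HasSum (fun k : ℕ => (k.factorial : ℂ)⁻¹ * (k * z ^ (k - 1))) (Complex.exp z) := by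
  have h (k : ℕ) : ((k + 1).factorial : ℂ)⁻¹ * ((k + 1 : ℕ) * z ^ (k + 1 - 1)) =
      (k.factorial : ℂ)⁻¹ * z ^ k := by
    have h₁ : ((k : ℂ) + 1) ≠ 0 := by exact_mod_cast k.succ_ne_zero
    have h₂ : (k.factorial : ℂ) ≠ 0 := by exact_mod_cast k.factorial_ne_zero
    rw [Nat.factorial_succ, Nat.add_sub_cancel]
    push_cast
    field_simp
  rw [← hasSum_nat_add_iff' 1]
  simpa only [h, Finset.range_one, Finset.sum_singleton, Nat.cast_zero, zero_mul, mul_zero,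
    sub_zero] using hasSum_inv_factorial_mul_pow z

/-- `exp (s + t ζ_vec) = exp s * (C t + S t * ζ_vec)`, where `C` and `S` solve the linear
system `C' = ζ_vec² S`, `S' = C`. -/
theorem exists_qexp_smul_one_add_smul_zvec (ζ : ℂ × ℂ) :
    ∃ C S : ℂ → ℂ, (∀ t, HasDerivAt C (-(ζ.1 ^ 2 + ζ.2 ^ 2) * S t) t) ∧
      (∀ t, HasDerivAt S (C t) t) ∧
      ∀ s t : ℂ, qexp (s • (1 : ℍ[ℂ]) + t • zvec ζ) =
        cliffordMk (Complex.exp s * C t) (Complex.exp s * S t * ζ.1) (Complex.exp s * S t * ζ.2) 0 := by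
  obtain ⟨w, hw⟩ := IsAlgClosed.exists_pow_nat_eq (-(ζ.1 ^ 2 + ζ.2 ^ 2)) two_pos
  by_cases h0 : w = 0
  · have hz : ζ.1 ^ 2 + ζ.2 ^ 2 = 0 := by simpa [h0, eq_comm, -neg_add_rev] using hw
    refine ⟨fun _ => 1, fun t => t, fun t => ?_, fun t => hasDerivAt_id t, fun s t => ?_⟩
    · simpa [hz] using hasDerivAt_const t (1 : ℂ)
    · refine qexp_smul_one_add_smul_zvec ζ s t (fun k => s ^ k) (fun k => k * s ^ (k - 1) * t)
        (by simp) (by simp) (fun k => ?_) (fun k => ?_) ?_ ?_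
      · rw [hz, pow_succ']
        ring
      · rcases k with _ | k
        · simp
        · simp only [Nat.add_sub_cancel]
          push_cast
          ring
      · simpa using hasSum_inv_factorial_mul_pow s
      · simpa only [mul_assoc] using
          (hasSum_inv_factorial_mul_natCast_mul_pow_pred s).mul_right t
  · have hz : ζ.1 ^ 2 + ζ.2 ^ 2 = -w ^ 2 := by rw [hw, neg_neg]
    have hd (c t : ℂ) : HasDerivAt (fun t => Complex.exp (t * c)) (Complex.exp (t * c) * c) t := by
      simpa using ((hasDerivAt_id t).mul_const c).cexp
    refine ⟨fun t => (Complex.exp (t * w) + Complex.exp (t * -w)) / 2,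
      fun t => (Complex.exp (t * w) - Complex.exp (t * -w)) / (2 * w),
      fun t => ?_, fun t => ?_, fun s t => ?_⟩
    · refine (((hd w t).add (hd (-w) t)).div_const 2).congr_deriv ?_
      rw [hz]
      field_simp
      ring
    · refine (((hd w t).sub (hd (-w) t)).div_const (2 * w)).congr_deriv ?_
      field_simp
      ring
    · refine qexp_smul_one_add_smul_zvec ζ s t
        (fun k => ((s + t * w) ^ k + (s + t * -w) ^ k) / 2)
        (fun k => ((s + t * w) ^ k - (s + t * -w) ^ k) / (2 * w))
        (by simp) (by simp) (fun k => ?_) (fun k => ?_) ?_ ?_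
      · simp only [hz]
        field_simp
        ring
      · field_simp
        ring
      · have h := ((hasSum_inv_factorial_mul_pow (s + t * w)).add
          (hasSum_inv_factorial_mul_pow (s + t * -w))).div_const 2
        simpa only [Complex.exp_add, ← mul_add, mul_div_assoc] using h
      · have h := ((hasSum_inv_factorial_mul_pow (s + t * w)).sub
          (hasSum_inv_factorial_mul_pow (s + t * -w))).div_const (2 * w)
        simpa only [Complex.exp_add, ← mul_sub, mul_div_assoc] using h

/-- The derivative on `ℝ³` of `exp s * F t`, with `s = i (x₁ ζ₁ + x₂ ζ₂)` and `t = -i x₀`. -/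
theorem exists_hasFDerivAt_exp_mul (ζ : ℂ × ℂ) {F : ℂ → ℂ} {F' : ℂ} (x : Fin 3 → ℝ)
    (hF : HasDerivAt F F' (-(Complex.I * (x 0 : ℂ)))) :
    ∃ L : (Fin 3 → ℝ) →L[ℝ] ℂ,
      HasFDerivAt (fun y : Fin 3 → ℝ =>
        Complex.exp (Complex.I * ((y 1 : ℂ) * ζ.1 + (y 2 : ℂ) * ζ.2)) *
          F (-(Complex.I * (y 0 : ℂ)))) L x ∧
      ∀ v, L v = Complex.exp (Complex.I * ((x 1 : ℂ) * ζ.1 + (x 2 : ℂ) * ζ.2)) *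
        (Complex.I * ((v 1 : ℂ) * ζ.1 + (v 2 : ℂ) * ζ.2) * F (-(Complex.I * (x 0 : ℂ)))
          - Complex.I * (v 0 : ℂ) * F') := by
  have hc (j : Fin 3) : HasFDerivAt (fun y : Fin 3 → ℝ => (y j : ℂ))
      (Complex.ofRealCLM.comp (ContinuousLinearMap.proj j)) x :=
    (Complex.ofRealCLM.comp (ContinuousLinearMap.proj (R := ℝ) (φ := fun _ => ℝ) j)).hasFDerivAt
  have hs := ((((hc 1).mul_const ζ.1).add ((hc 2).mul_const ζ.2)).const_mul Complex.I).cexp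
  have ht := (hF.hasFDerivAt.restrictScalars ℝ).comp x ((hc 0).const_mul Complex.I).neg
  refine ⟨_, hs.mul ht, fun v => ?_⟩
  simp
  ring

/-- The exponential `E₁` is left and right monogenic: for every `ζ ∈ ℂ²`, `x ↦ E₁(x,ζ)` is
differentiable on `ℝ³` and `D⁽ˡ⁾E₁(·,ζ) = 0`, `D⁽ʳ⁾E₁(·,ζ) = 0` on all of `ℝ³`. -/
theorem E1_monogenic (ζ : ℂ × ℂ) :
    (∀ x : Fin 3 → ℝ, QDiffAt (fun y => E1 y ζ) x) ∧
    (∀ x : Fin 3 → ℝ, Dl (fun y => E1 y ζ) x = 0 ∧ Dr (fun y => E1 y ζ) x = 0) := by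
  obtain ⟨C, S, hC, hS, hE⟩ := exists_qexp_smul_one_add_smul_zvec ζ
  have hE1 (y : Fin 3 → ℝ) : E1 y ζ =
      let s := Complex.I * ((y 1 : ℂ) * ζ.1 + (y 2 : ℂ) * ζ.2)
      let t := -(Complex.I * (y 0 : ℂ))
      cliffordMk (Complex.exp s * C t) (Complex.exp s * S t * ζ.1) (Complex.exp s * S t * ζ.2) 0 := by
    rw [← hE, E1]
    congr 1
    apply Quaternion.ext <;> simp
  simp only [hE1]
  refine ⟨fun x => ?_, fun x => ?_⟩ <;>
    obtain ⟨L, hL, hLv⟩ := exists_hasFDerivAt_exp_mul ζ x (hC _) <;>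
    obtain ⟨M, hM, hMv⟩ := exists_hasFDerivAt_exp_mul ζ x (hS _)
  · exact ⟨hL.differentiableAt, hM.differentiableAt.mul_const _,
      hM.differentiableAt.mul_const _, differentiableAt_const _⟩
  · have h₁ := (hM.mul_const ζ.1).fderiv
    have h₂ := (hM.mul_const ζ.2).fderiv
    constructor <;> apply Quaternion.ext <;>
      simp [Dl, Dr, hL.fderiv, h₁, h₂, hLv, hMv] <;> ring
end
end

section
/- Hyperbolic representation of E₁: let ζ = (ζ₁,ζ₂) ∈ ℂ² and let w ∈ ℂ with w ≠ 0 and w² = ζ₁² + ζ₂² (a square root of the holomorphically extended norm |ζ|_ℂ²). Then for all x ∈ ℝ³: E₁(x,ζ) = e^{i(x₁ζ₁ + x₂ζ₂)} · ( cosh(x₀·w)·e₀ − (sinh(x₀·w)/w)·i·ζ_vec ). -/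
open scoped Quaternion

noncomputable section

/-- Components of the powers of the complex quaternion `A = a + t u`, where `u` is purely imaginary
with `u² = w²`, through `a + t w` and `a - t w`. -/
theorem pow_components (A : ℍ[ℂ]) (a t u₁ u₂ u₃ w : ℂ) (hw : w ≠ 0)
    (hw2 : w ^ 2 = -(u₁ ^ 2 + u₂ ^ 2 + u₃ ^ 2)) (hre : A.re = a) (hI : A.imI = t * u₁)
    (hJ : A.imJ = t * u₂) (hK : A.imK = t * u₃) (k : ℕ) :
    (A ^ k).re = ((a + t * w) ^ k + (a - t * w) ^ k) / 2 ∧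
    (A ^ k).imI = ((a + t * w) ^ k - (a - t * w) ^ k) / 2 * (u₁ / w) ∧
    (A ^ k).imJ = ((a + t * w) ^ k - (a - t * w) ^ k) / 2 * (u₂ / w) ∧
    (A ^ k).imK = ((a + t * w) ^ k - (a - t * w) ^ k) / 2 * (u₃ / w) := by
  induction k with
  | zero =>
    rw [pow_zero]
    simp
  | succ k ih =>
    obtain ⟨h0, h1, h2, h3⟩ := ih
    rw [pow_succ, Quaternion.re_mul, Quaternion.imI_mul, Quaternion.imJ_mul, Quaternion.imK_mul,
      h0, h1, h2, h3, hre, hI, hJ, hK]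
    refine ⟨?_, ?_, ?_, ?_⟩
    · field_simp
      linear_combination (-t * ((a + t * w) ^ k - (a - t * w) ^ k)) * hw2
    all_goals
      field_simp
      ring

/-- The combinations of the exponential series at `a + c` and `a - c` that give `cosh` and
`sinh`. -/
theorem hasSum_pow_add_pow_sub (a c r s : ℂ) :
    HasSum (fun k : ℕ => (k.factorial : ℂ)⁻¹ *
        (((a + c) ^ k + (a - c) ^ k) / 2 * r + ((a + c) ^ k - (a - c) ^ k) / 2 * s))
      (Complex.exp a * (Complex.cosh c * r + Complex.sinh c * s)) := by
  have hexp (z : ℂ) : HasSum (fun k : ℕ => (k.factorial : ℂ)⁻¹ * z ^ k) (Complex.exp z) := by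
    simpa [Complex.exp_eq_exp_ℂ, smul_eq_mul] using NormedSpace.exp_series_hasSum_exp' (𝕂 := ℂ) z
  have h := ((hexp (a + c)).mul_right ((r + s) / 2)).add
    ((hexp (a - c)).mul_right ((r - s) / 2))
  have hval : Complex.exp a * (Complex.cosh c * r + Complex.sinh c * s) =
      Complex.exp (a + c) * ((r + s) / 2) + Complex.exp (a - c) * ((r - s) / 2) := by
    rw [← Complex.cosh_add_sinh (a + c), ← Complex.cosh_add_sinh (a - c),
      ← Complex.cosh_add_sinh a, Complex.cosh_add, Complex.sinh_add, Complex.cosh_sub,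
      Complex.sinh_sub]
    ring
  rw [hval]
  refine (congrArg (HasSum · _) (funext fun k => ?_)).mpr h
  ring

/-- Hyperbolic representation of `E₁`: if `w ≠ 0` and `w² = ζ₁² + ζ₂²`, then
`E₁(x,ζ) = e^{i(x₁ζ₁ + x₂ζ₂)} (cosh(x₀w) e₀ − (sinh(x₀w)/w) i ζ_vec)`. -/
theorem E1_hyperbolic (ζ : ℂ × ℂ) (w : ℂ) (hw : w ≠ 0) (hw2 : w ^ 2 = ζ.1 ^ 2 + ζ.2 ^ 2)
    (x : Fin 3 → ℝ) :
    E1 x ζ = Complex.exp (Complex.I * ((x 1 : ℂ) * ζ.1 + (x 2 : ℂ) * ζ.2)) •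
      (Complex.cosh ((x 0 : ℂ) * w) • (1 : ℍ[ℂ]) -
        (Complex.sinh ((x 0 : ℂ) * w) / w * Complex.I) • zvec ζ) := by
  set a : ℂ := Complex.I * ((x 1 : ℂ) * ζ.1 + (x 2 : ℂ) * ζ.2) with ha
  have hsum (r s : ℂ) := (hasSum_pow_add_pow_sub a (x 0 * w) r s).tsum_eq
  have hpow (k : ℕ) := pow_components (a • (1 : ℍ[ℂ]) - (Complex.I * (x 0 : ℂ)) • zvec ζ) a (x 0)
    (-Complex.I * ζ.1) (-Complex.I * ζ.2) 0 w hw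
    (by linear_combination hw2 + (ζ.1 ^ 2 + ζ.2 ^ 2) * Complex.I_sq)
    (show a * 1 - Complex.I * x 0 * 0 = _ by ring)
    (show a * 0 - Complex.I * x 0 * ζ.1 = _ by ring)
    (show a * 0 - Complex.I * x 0 * ζ.2 = _ by ring)
    (show a * 0 - Complex.I * x 0 * 0 = _ by ring) k
  have hcosh := hsum 1 0
  have hsinh (s : ℂ) := hsum 0 s
  simp only [mul_one, mul_zero, add_zero, zero_add] at hcosh hsinh
  ext
  · change ∑' k : ℕ, _ = Complex.exp a * (Complex.cosh (x 0 * w) * 1 -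
      Complex.sinh (x 0 * w) / w * Complex.I * 0)
    simp only [← ha, (hpow _).1, hcosh]
    ring
  · change ∑' k : ℕ, _ = Complex.exp a * (Complex.cosh (x 0 * w) * 0 -
      Complex.sinh (x 0 * w) / w * Complex.I * ζ.1)
    simp only [← ha, (hpow _).2.1, hsinh]
    ring
  · change ∑' k : ℕ, _ = Complex.exp a * (Complex.cosh (x 0 * w) * 0 -
      Complex.sinh (x 0 * w) / w * Complex.I * ζ.2)
    simp only [← ha, (hpow _).2.2.1, hsinh]
    ring
  · change ∑' k : ℕ, _ = Complex.exp a * (Complex.cosh (x 0 * w) * 0 -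
      Complex.sinh (x 0 * w) / w * Complex.I * 0)
    simp only [← ha, (hpow _).2.2.2, hsinh]
    ring
end
end

section
/- E₂ is left and right monogenic: let ζ = (ζ₁,ζ₂) ∈ ℂ² and w ∈ ℂ with w ≠ 0 and w² = ζ₁² + ζ₂², and set E₂(x,ζ) = −(i·ζ_vec/w)·E₁(x,ζ). Then the function x ↦ E₂(x,ζ) satisfies D⁽ˡ⁾E₂(·,ζ) = 0 and D⁽ʳ⁾E₂(·,ζ) = 0 on all of ℝ³. -/
open scoped Quaternion

noncomputable section

section Components

variable (ζ : ℂ × ℂ) (j : Fin 3) (f : (Fin 3 → ℝ) → ℍ[ℂ]) (x : Fin 3 → ℝ) (a b c d : ℂ)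

/-- The complex quaternion with the given components. -/
def quatMk : ℍ[ℂ] := ⟨a, b, c, d⟩

@[simp] lemma quatMk_re : (quatMk a b c d).re = a := rfl
@[simp] lemma quatMk_imI : (quatMk a b c d).imI = b := rfl
@[simp] lemma quatMk_imJ : (quatMk a b c d).imJ = c := rfl
@[simp] lemma quatMk_imK : (quatMk a b c d).imK = d := rfl

lemma e1_eq_quatMk : e1 = quatMk 0 1 0 0 := rfl
lemma e2_eq_quatMk : e2 = quatMk 0 0 1 0 := rfl
lemma zvec_eq_quatMk : zvec ζ = quatMk 0 ζ.1 ζ.2 0 := rfl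

lemma pdQ_eq_quatMk : pdQ j f x = quatMk
    (fderiv ℝ (fun y => (f y).re) x (Pi.single j 1))
    (fderiv ℝ (fun y => (f y).imI) x (Pi.single j 1))
    (fderiv ℝ (fun y => (f y).imJ) x (Pi.single j 1))
    (fderiv ℝ (fun y => (f y).imK) x (Pi.single j 1)) := rfl

end Components

/-- Powers of `a - i t ζ_vec` in terms of the eigenvalues `a ± t w` of multiplication by it. -/
lemma pow_smul_one_sub_smul_zvec (ζ : ℂ × ℂ) (w : ℂ) (hw : w ≠ 0)
    (hw2 : w ^ 2 = ζ.1 ^ 2 + ζ.2 ^ 2) (a t : ℂ) (k : ℕ) :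
    (a • (1 : ℍ[ℂ]) - (Complex.I * t) • zvec ζ) ^ k =
      quatMk (((a + t * w) ^ k + (a - t * w) ^ k) / 2)
        (-(Complex.I / w) * ζ.1 * (((a + t * w) ^ k - (a - t * w) ^ k) / 2))
        (-(Complex.I / w) * ζ.2 * (((a + t * w) ^ k - (a - t * w) ^ k) / 2)) 0 := by
  have hI := Complex.I_sq
  induction k with
  | zero => ext <;> simp
  | succ k ih =>
    rw [pow_succ, ih]
    generalize hp : (a + t * w) ^ k = p
    generalize hm : (a - t * w) ^ k = m
    ext <;> simp [zvec_eq_quatMk, pow_succ, hp, hm] <;> field_simp <;> grind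

lemma qexp_smul_one_sub_smul_zvec (ζ : ℂ × ℂ) (w : ℂ) (hw : w ≠ 0)
    (hw2 : w ^ 2 = ζ.1 ^ 2 + ζ.2 ^ 2) (a t : ℂ) :
    qexp (a • (1 : ℍ[ℂ]) - (Complex.I * t) • zvec ζ) =
      quatMk ((Complex.exp (a + t * w) + Complex.exp (a - t * w)) / 2)
        (-(Complex.I / w) * ζ.1 * ((Complex.exp (a + t * w) - Complex.exp (a - t * w)) / 2))
        (-(Complex.I / w) * ζ.2 * ((Complex.exp (a + t * w) - Complex.exp (a - t * w)) / 2)) 0 := by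
  have hexp (z : ℂ) : HasSum (fun k : ℕ => (k.factorial : ℂ)⁻¹ * z ^ k) (Complex.exp z) := by
    simpa [Complex.exp_eq_exp_ℂ] using NormedSpace.exp_series_hasSum_exp' (𝕂 := ℂ) z
  have hadd := ((hexp (a + t * w)).add (hexp (a - t * w))).div_const 2
  have hsub := ((hexp (a + t * w)).sub (hexp (a - t * w))).div_const 2
  have hvec (c : ℂ) := (hsub.mul_left (-(Complex.I / w) * c)).tsum_eq
  simp only [qexp, quatMk_re, quatMk_imI, quatMk_imJ, quatMk_imK,
    pow_smul_one_sub_smul_zvec ζ w hw hw2]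
  ext
  · exact (tsum_congr fun k => by ring).trans hadd.tsum_eq
  · exact (tsum_congr fun k => by ring).trans (hvec ζ.1)
  · exact (tsum_congr fun k => by ring).trans (hvec ζ.2)
  · simp

lemma fderiv_plane_wave (ζ : ℂ × ℂ) (w α β : ℂ) (x v : Fin 3 → ℝ) :
    fderiv ℝ (fun y : Fin 3 → ℝ =>
        α * Complex.exp (Complex.I * ((y 1 : ℂ) * ζ.1 + (y 2 : ℂ) * ζ.2) + (y 0 : ℂ) * w) +
        β * Complex.exp (Complex.I * ((y 1 : ℂ) * ζ.1 + (y 2 : ℂ) * ζ.2) - (y 0 : ℂ) * w)) x v =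
      α * (Complex.exp (Complex.I * ((x 1 : ℂ) * ζ.1 + (x 2 : ℂ) * ζ.2) + (x 0 : ℂ) * w) *
        (Complex.I * ((v 1 : ℂ) * ζ.1 + (v 2 : ℂ) * ζ.2) + (v 0 : ℂ) * w)) +
      β * (Complex.exp (Complex.I * ((x 1 : ℂ) * ζ.1 + (x 2 : ℂ) * ζ.2) - (x 0 : ℂ) * w) *
        (Complex.I * ((v 1 : ℂ) * ζ.1 + (v 2 : ℂ) * ζ.2) - (v 0 : ℂ) * w)) := by
  have hc (j : Fin 3) : HasFDerivAt (fun y : Fin 3 → ℝ => (y j : ℂ))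
      (Complex.ofRealCLM ∘L ContinuousLinearMap.proj j) x :=
    (Complex.ofRealCLM ∘L ContinuousLinearMap.proj (R := ℝ) (φ := fun _ : Fin 3 => ℝ) j).hasFDerivAt
  have hplane := (((hc 1).mul_const ζ.1).add ((hc 2).mul_const ζ.2)).const_mul Complex.I
  have hp := ((hplane.add ((hc 0).mul_const w)).cexp).const_mul α
  have hm := ((hplane.sub ((hc 0).mul_const w)).cexp).const_mul β
  refine (congrArg (fun L => L v) (hp.add hm).fderiv).trans ?_
  simp
  ring

/-- `E₂(x,ζ) = −(i ζ_vec / w) E₁(x,ζ)` is left and right monogenic on all of `ℝ³`,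
whenever `w ≠ 0` and `w² = ζ₁² + ζ₂²`. -/
theorem E2_monogenic (ζ : ℂ × ℂ) (w : ℂ) (hw : w ≠ 0) (hw2 : w ^ 2 = ζ.1 ^ 2 + ζ.2 ^ 2) :
    ∀ x : Fin 3 → ℝ,
      Dl (fun y => (-(Complex.I / w)) • (zvec ζ * E1 y ζ)) x = 0 ∧
      Dr (fun y => (-(Complex.I / w)) • (zvec ζ * E1 y ζ)) x = 0 := by
  intro x
  have hI := Complex.I_sq
  have hE2 : (fun y => (-(Complex.I / w)) • (zvec ζ * E1 y ζ)) = fun y : Fin 3 → ℝ =>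
      let p := Complex.exp (Complex.I * ((y 1 : ℂ) * ζ.1 + (y 2 : ℂ) * ζ.2) + (y 0 : ℂ) * w)
      let m := Complex.exp (Complex.I * ((y 1 : ℂ) * ζ.1 + (y 2 : ℂ) * ζ.2) - (y 0 : ℂ) * w)
      quatMk (1 / 2 * p + -1 / 2 * m)
        (-(Complex.I / w) * ζ.1 / 2 * p + -(Complex.I / w) * ζ.1 / 2 * m)
        (-(Complex.I / w) * ζ.2 / 2 * p + -(Complex.I / w) * ζ.2 / 2 * m)
        (0 * p + 0 * m) := by
    funext y
    simp only [E1, qexp_smul_one_sub_smul_zvec ζ w hw hw2]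
    ext <;> simp [zvec_eq_quatMk] <;> field_simp <;> grind
  rw [hE2]
  simp only [Dl, Dr, pdQ_eq_quatMk, quatMk_re, quatMk_imI, quatMk_imJ,
    quatMk_imK, fderiv_plane_wave]
  constructor <;> ext <;> simp [e1_eq_quatMk, e2_eq_quatMk] <;> field_simp <;> grind
end
end

section
/- E is left and right monogenic: let ζ = (ζ₁,ζ₂) ∈ ℂ² and w ∈ ℂ with w ≠ 0 and w² = ζ₁² + ζ₂², and define E(x,ζ) = e^{i(x₁ζ₁ + x₂ζ₂) − x₀·w} · ( e₀ + (i·ζ_vec)/w ). Then the function x ↦ E(x,ζ) satisfies D⁽ˡ⁾E(·,ζ) = 0 and D⁽ʳ⁾E(·,ζ) = 0 on all of ℝ³. -/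
open scoped Quaternion

noncomputable section

/-- The real partial derivatives of a constant quaternion scaled by a complex exponential. -/
theorem pdQ_exp_smul (ζ : ℂ × ℂ) (w : ℂ) (A : ℍ[ℂ]) (j : Fin 3) (x : Fin 3 → ℝ) :
    pdQ j (fun y =>
        Complex.exp (Complex.I * ((y 1 : ℂ) * ζ.1 + (y 2 : ℂ) * ζ.2) - (y 0 : ℂ) * w) • A) x =
      (![-w, Complex.I * ζ.1, Complex.I * ζ.2] j *
        Complex.exp (Complex.I * ((x 1 : ℂ) * ζ.1 + (x 2 : ℂ) * ζ.2) - (x 0 : ℂ) * w)) • A := by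
  have hcoord (k : Fin 3) : HasFDerivAt (fun y : Fin 3 → ℝ => (y k : ℂ))
      (Complex.ofRealCLM.comp (ContinuousLinearMap.proj (R := ℝ) (φ := fun _ : Fin 3 => ℝ) k)) x :=
    (Complex.ofRealCLM.comp
      (ContinuousLinearMap.proj (R := ℝ) (φ := fun _ : Fin 3 => ℝ) k)).hasFDerivAt
  have hexp := (((((hcoord 1).mul_const ζ.1).add ((hcoord 2).mul_const ζ.2)).const_mul
    Complex.I).sub ((hcoord 0).mul_const w)).cexp
  have hpart (a : ℂ) : fderiv ℝ (fun y : Fin 3 → ℝ =>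
      Complex.exp (Complex.I * ((y 1 : ℂ) * ζ.1 + (y 2 : ℂ) * ζ.2) - (y 0 : ℂ) * w) * a) x
        (Pi.single j 1) =
      (![-w, Complex.I * ζ.1, Complex.I * ζ.2] j *
        Complex.exp (Complex.I * ((x 1 : ℂ) * ζ.1 + (x 2 : ℂ) * ζ.2) - (x 0 : ℂ) * w)) * a := by
    refine (congrArg (fun L => L (Pi.single j 1)) (hexp.mul_const a).fderiv).trans ?_
    fin_cases j <;> simp <;> ring
  ext
  · exact hpart A.re
  · exact hpart A.imI
  · exact hpart A.imJ
  · exact hpart A.imK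

/-- `E(x,ζ) = e^{i(x₁ζ₁ + x₂ζ₂) − x₀w} (e₀ + i ζ_vec / w)` is left and right monogenic on
all of `ℝ³`, whenever `w ≠ 0` and `w² = ζ₁² + ζ₂²`. -/
theorem E_monogenic (ζ : ℂ × ℂ) (w : ℂ) (hw : w ≠ 0) (hw2 : w ^ 2 = ζ.1 ^ 2 + ζ.2 ^ 2) :
    ∀ x : Fin 3 → ℝ,
      Dl (fun y => Complex.exp (Complex.I * ((y 1 : ℂ) * ζ.1 + (y 2 : ℂ) * ζ.2) - (y 0 : ℂ) * w) •
          ((1 : ℍ[ℂ]) + (Complex.I / w) • zvec ζ)) x = 0 ∧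
      Dr (fun y => Complex.exp (Complex.I * ((y 1 : ℂ) * ζ.1 + (y 2 : ℂ) * ζ.2) - (y 0 : ℂ) * w) •
          ((1 : ℍ[ℂ]) + (Complex.I / w) • zvec ζ)) x = 0 := by
  intro x
  have he1 : e1.re = 0 ∧ e1.imI = 1 ∧ e1.imJ = 0 ∧ e1.imK = 0 := ⟨rfl, rfl, rfl, rfl⟩
  have he2 : e2.re = 0 ∧ e2.imI = 0 ∧ e2.imJ = 1 ∧ e2.imK = 0 := ⟨rfl, rfl, rfl, rfl⟩
  have hz : (zvec ζ).re = 0 ∧ (zvec ζ).imI = ζ.1 ∧ (zvec ζ).imJ = ζ.2 ∧ (zvec ζ).imK = 0 :=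
    ⟨rfl, rfl, rfl, rfl⟩
  constructor <;>
  · simp only [Dl, Dr, pdQ_exp_smul]
    generalize Complex.exp _ = c
    ext <;> simp [he1, he2, hz] <;> field_simp <;> ring_nf
    linear_combination (-c) * hw2 - c * (ζ.1 ^ 2 + ζ.2 ^ 2) * Complex.I_sq
end
end
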